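/- Let X : ℝ⁴ → (Fin 4 → Fin 4 → ℝ) be a smooth field of antisymmetric matrices that is both closed (∂_a X_{bc} + ∂_b X_{ca} + ∂_c X_{ab} = 0 everywhere) and co-closed (∂_b X^{ab} = 0 everywhere). Then there exist two smooth co-potential vector fields U, V : ℝ⁴ → (Fin 4 → ℝ) such that X_{ab} = ∂_a U_b − ∂_b U_a and (*X)_{ab} = ∂_a V_b − ∂_b V_a at every point. -/

import Mathlib

noncomputable section

/-- The Minkowski metric diag(-1,1,1,1); it equals its own inverse. -/
def mink : Fin 4 → Fin 4 → ℝ :=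
  fun a b => if a = b then (if a = 0 then -1 else 1) else 0

/-- The Levi-Civita symbol, totally antisymmetric with `lev 0 1 2 3 = 1`. -/
def lev (a b c d : Fin 4) : ℝ :=
  (((b : ℕ) : ℝ) - ((a : ℕ) : ℝ)) * (((c : ℕ) : ℝ) - ((a : ℕ) : ℝ)) *
      (((d : ℕ) : ℝ) - ((a : ℕ) : ℝ)) * (((c : ℕ) : ℝ) - ((b : ℕ) : ℝ)) *
      (((d : ℕ) : ℝ) - ((b : ℕ) : ℝ)) * (((d : ℕ) : ℝ) - ((c : ℕ) : ℝ)) / 12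

/-- Raise one index with the metric: `A^a = η^{ab} A_b`. -/
def raise1 (A : Fin 4 → ℝ) : Fin 4 → ℝ :=
  fun a => ∑ b, mink a b * A b

/-- Raise both indices of a second rank tensor: `X^{ab} = η^{ac} η^{bd} X_{cd}`. -/
def raise2 (X : Fin 4 → Fin 4 → ℝ) : Fin 4 → Fin 4 → ℝ :=
  fun a b => ∑ c, ∑ d, mink a c * mink b d * X c d

/-- The Hodge dual of a second rank tensor: `(*X)_{ab} = (1/2) ε_{abcd} X^{cd}`. -/
def hodge (X : Fin 4 → Fin 4 → ℝ) : Fin 4 → Fin 4 → ℝ :=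
  fun a b => (1 / 2) * ∑ c, ∑ d, lev a b c d * raise2 X c d

/-- The partial derivative of a function on ℝ⁴ in the `a`-th coordinate direction. -/
def pd (a : Fin 4) (f : (Fin 4 → ℝ) → ℝ) (x : Fin 4 → ℝ) : ℝ :=
  fderiv ℝ f x (Pi.single a 1)

/-- The α-current of a field of antisymmetric matrices: `Z^a = ∂_b X^{ab}`. -/
def alphaCurrent (X : (Fin 4 → ℝ) → Fin 4 → Fin 4 → ℝ) (a : Fin 4) (x : Fin 4 → ℝ) : ℝ :=
  ∑ b, pd b (fun y => raise2 (X y) a b) x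

/-- The β-current of a field of antisymmetric matrices: `Y^a = ∂_b (*X)^{ab}`. -/
def betaCurrent (X : (Fin 4 → ℝ) → Fin 4 → Fin 4 → ℝ) (a : Fin 4) (x : Fin 4 → ℝ) : ℝ :=
  ∑ b, pd b (fun y => raise2 (hodge (X y)) a b) x


open MeasureTheory intervalIntegral Set Filter Topology

lemma aux_fderiv_smooth (F : (Fin 4 → ℝ) → ℝ → ℝ)
    (hF : ContDiff ℝ (⊤ : ℕ∞) (Function.uncurry F)) :
    ContDiff ℝ (⊤ : ℕ∞) (Function.uncurry fun (x : Fin 4 → ℝ) (t : ℝ) =>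
      fderiv ℝ (fun y => F y t) x) := by
  have hF2 : ContDiff ℝ (⊤ : ℕ∞)
      (Function.uncurry fun (p : (Fin 4 → ℝ) × ℝ) (y : Fin 4 → ℝ) => F y p.2) :=
    hF.comp (contDiff_snd.prodMk (contDiff_snd.comp contDiff_fst))
  exact ContDiff.fderiv (m := (⊤ : ℕ∞)) (n := (⊤ : ℕ∞)) hF2 contDiff_fst (by simp)

lemma aux_hasFDerivAt (F : (Fin 4 → ℝ) → ℝ → ℝ)
    (hF : ContDiff ℝ (⊤ : ℕ∞) (Function.uncurry F)) (x : Fin 4 → ℝ) :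
    HasFDerivAt (fun x => ∫ t in (0:ℝ)..1, F x t)
      (∫ t in (0:ℝ)..1, fderiv ℝ (fun y => F y t) x) x := by
  have hd : Continuous (Function.uncurry fun (x : Fin 4 → ℝ) (t : ℝ) =>
      fderiv ℝ (fun y => F y t) x) :=
    (aux_fderiv_smooth F hF).continuous
  obtain ⟨C, hC⟩ := ((isCompact_closedBall x (1:ℝ)).prod (isCompact_Icc (a := (0:ℝ)) (b := 1))).exists_bound_of_continuousOn
    hd.continuousOn
  refine intervalIntegral.hasFDerivAt_integral_of_dominated_of_fderiv_le
    (F' := fun x t => fderiv ℝ (fun y => F y t) x) (bound := fun _ => C)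
    (Metric.closedBall_mem_nhds x one_pos) ?_ ?_ ?_ ?_ ?_ ?_
  · refine Eventually.of_forall fun y => ?_
    exact (hF.continuous.comp (by fun_prop : Continuous fun t : ℝ => (y, t))).aestronglyMeasurable
  · exact (hF.continuous.comp (by fun_prop : Continuous fun t : ℝ => (x, t))).intervalIntegrable _ _
  · exact (hd.comp (by fun_prop : Continuous fun t : ℝ => (x, t))).aestronglyMeasurable
  · refine Eventually.of_forall fun t ht y hy => ?_
    rw [uIoc_of_le zero_le_one] at ht
    exact hC (y, t) ⟨hy, ht.1.le, ht.2⟩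
  · exact intervalIntegrable_const
  · refine Eventually.of_forall fun t ht y hy => ?_
    have : ContDiff ℝ (⊤ : ℕ∞) (fun y => F y t) :=
      hF.comp (contDiff_id.prodMk contDiff_const)
    exact (this.differentiable (by simp) y).hasFDerivAt

lemma aux_fderiv_apply (F : (Fin 4 → ℝ) → ℝ → ℝ)
    (hF : ContDiff ℝ (⊤ : ℕ∞) (Function.uncurry F)) (x v : Fin 4 → ℝ) :
    fderiv ℝ (fun x => ∫ t in (0:ℝ)..1, F x t) x v =
      ∫ t in (0:ℝ)..1, fderiv ℝ (fun y => F y t) x v := by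
  rw [(aux_hasFDerivAt F hF x).fderiv]
  refine ContinuousLinearMap.intervalIntegral_apply ?_ v
  exact ((aux_fderiv_smooth F hF).continuous.comp
    (by fun_prop : Continuous fun t : ℝ => (x, t))).intervalIntegrable _ _

lemma aux_contDiff_nat (n : ℕ) : ∀ (F : (Fin 4 → ℝ) → ℝ → ℝ),
    ContDiff ℝ (⊤ : ℕ∞) (Function.uncurry F) →
    ContDiff ℝ n (fun x => ∫ t in (0:ℝ)..1, F x t) := by
  induction n with
  | zero =>
    intro F hF
    have h : Differentiable ℝ (fun x => ∫ t in (0:ℝ)..1, F x t) :=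
      fun x => (aux_hasFDerivAt F hF x).differentiableAt
    exact contDiff_zero.2 h.continuous
  | succ n ih =>
    intro F hF
    push_cast
    refine contDiff_succ_iff_fderiv_apply.2
      ⟨fun x => (aux_hasFDerivAt F hF x).differentiableAt, fun h => by simp at h, fun v => ?_⟩
    simp_rw [aux_fderiv_apply F hF]
    exact ih _ ((aux_fderiv_smooth F hF).clm_apply contDiff_const)

lemma aux_contDiff (F : (Fin 4 → ℝ) → ℝ → ℝ)
    (hF : ContDiff ℝ (⊤ : ℕ∞) (Function.uncurry F)) :
    ContDiff ℝ (⊤ : ℕ∞) (fun x => ∫ t in (0:ℝ)..1, F x t) :=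
  contDiff_infty.2 fun n => aux_contDiff_nat n F hF

lemma aux_expand (L : (Fin 4 → ℝ) →L[ℝ] ℝ) (x : Fin 4 → ℝ) :
    L x = ∑ a, x a * L (Pi.single a 1) := by
  conv_lhs => rw [pi_eq_sum_univ' x]
  rw [map_sum]
  refine Finset.sum_congr rfl fun a _ => ?_
  rw [map_smul, smul_eq_mul]

/-- Integrand of the homotopy operator. -/
def homI (X : (Fin 4 → ℝ) → Fin 4 → Fin 4 → ℝ) (b : Fin 4) (x : Fin 4 → ℝ) (t : ℝ) : ℝ :=
  ∑ a, t * x a * X (t • x) a b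

lemma homI_smooth (X : (Fin 4 → ℝ) → Fin 4 → Fin 4 → ℝ)
    (hsmooth : ∀ a b, ContDiff ℝ (⊤ : ℕ∞) (fun x => X x a b)) (b : Fin 4) :
    ContDiff ℝ (⊤ : ℕ∞) (Function.uncurry (homI X b)) := by
  unfold homI Function.uncurry
  refine ContDiff.sum fun a _ => ContDiff.mul (by fun_prop) ?_
  exact (hsmooth a b).comp (by fun_prop : ContDiff ℝ (⊤ : ℕ∞)
    fun p : (Fin 4 → ℝ) × ℝ => p.2 • p.1)

lemma homI_pd (X : (Fin 4 → ℝ) → Fin 4 → Fin 4 → ℝ)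
    (hsmooth : ∀ a b, ContDiff ℝ (⊤ : ℕ∞) (fun x => X x a b)) (b c : Fin 4)
    (x : Fin 4 → ℝ) (t : ℝ) :
    fderiv ℝ (fun y => homI X b y t) x (Pi.single c 1) =
      t * X (t • x) c b + ∑ a, t ^ 2 * x a * pd c (fun y => X y a b) (t • x) := by
  have h1 : ∀ a, HasFDerivAt (fun y : Fin 4 → ℝ => t * y a * X (t • y) a b)
      ((t * x a) • ((fderiv ℝ (fun y => X y a b) (t • x)).comp
        (t • ContinuousLinearMap.id ℝ (Fin 4 → ℝ))) +
        X (t • x) a b • (t • ContinuousLinearMap.proj (R := ℝ) (φ := fun _ : Fin 4 => ℝ) a)) x := by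
    intro a
    have e1 : HasFDerivAt (fun y : Fin 4 → ℝ => t * y a)
        (t • ContinuousLinearMap.proj (R := ℝ) (φ := fun _ : Fin 4 => ℝ) a) x :=
      (hasFDerivAt_apply a x).const_mul t
    have e2 : HasFDerivAt (fun y : Fin 4 → ℝ => t • y)
        (t • ContinuousLinearMap.id ℝ (Fin 4 → ℝ)) x := (hasFDerivAt_id x).const_smul t
    have e3 : HasFDerivAt (fun y => X y a b) (fderiv ℝ (fun y => X y a b) (t • x)) (t • x) :=
      ((hsmooth a b).differentiable (by simp) _).hasFDerivAt
    exact e1.mul (e3.comp x e2)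
  have h2 := HasFDerivAt.fun_sum (u := Finset.univ) fun a _ => h1 a
  unfold homI
  rw [h2.fderiv]
  simp only [sum_apply, add_apply,
    smul_apply, ContinuousLinearMap.comp_apply, Finset.sum_add_distrib,
    ContinuousLinearMap.proj_apply, ContinuousLinearMap.id_apply, map_smul, smul_eq_mul]
  rw [add_comm]
  congr 1
  · rw [Finset.sum_eq_single c]
    · simp; ring
    · intro a _ ha; simp [ha]
    · simp
  · refine Finset.sum_congr rfl fun a _ => ?_
    unfold pd; ring

lemma poincare2 (X : (Fin 4 → ℝ) → Fin 4 → Fin 4 → ℝ)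
    (hanti : ∀ x a b, X x a b = - X x b a)
    (hsmooth : ∀ a b, ContDiff ℝ (⊤ : ℕ∞) (fun x => X x a b))
    (hclosed : ∀ (x : Fin 4 → ℝ) (a b c : Fin 4),
      pd a (fun y => X y b c) x + pd b (fun y => X y c a) x
        + pd c (fun y => X y a b) x = 0) :
    ∃ U : (Fin 4 → ℝ) → Fin 4 → ℝ,
      (∀ a, ContDiff ℝ (⊤ : ℕ∞) (fun x => U x a)) ∧
      (∀ (x : Fin 4 → ℝ) (a b : Fin 4),
        X x a b = pd a (fun y => U y b) x - pd b (fun y => U y a) x) := by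
  refine ⟨fun x b => ∫ t in (0:ℝ)..1, homI X b x t,
    fun b => aux_contDiff _ (homI_smooth X hsmooth b), fun x c b => ?_⟩
  have hpa : ∀ z a b c, pd c (fun y => X y a b) z = - pd c (fun y => X y b a) z := by
    intro z a b c
    have : (fun y => X y a b) = fun y => - X y b a := funext fun y => hanti y a b
    rw [this]; simp [pd]
  have hint : ∀ b c, IntervalIntegrable
      (fun t => fderiv ℝ (fun y => homI X b y t) x (Pi.single c 1)) volume 0 1 := fun b c =>
    ((((aux_fderiv_smooth _ (homI_smooth X hsmooth b)).clm_apply contDiff_const).continuous).comp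
      (by fun_prop : Continuous fun t : ℝ => (x, t))).intervalIntegrable _ _
  unfold pd
  rw [aux_fderiv_apply _ (homI_smooth X hsmooth b), aux_fderiv_apply _ (homI_smooth X hsmooth c),
    ← intervalIntegral.integral_sub (hint b c) (hint c b)]
  rw [integral_eq_sub_of_hasDerivAt (f := fun t => t ^ 2 * X (t • x) c b) ?_
    ((hint b c).sub (hint c b))]
  · simp
  · intro t _
    have e2 : HasDerivAt (fun t : ℝ => t • x) x t := by
      simpa using (hasDerivAt_id t).smul_const x
    have e3 : HasFDerivAt (fun y => X y c b) (fderiv ℝ (fun y => X y c b) (t • x)) (t • x) :=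
      ((hsmooth c b).differentiable (by simp) _).hasFDerivAt
    have e4 := (hasDerivAt_pow 2 t).mul (e3.comp_hasDerivAt t e2)
    refine e4.congr_deriv ?_
    rw [homI_pd X hsmooth, homI_pd X hsmooth, aux_expand (fderiv ℝ (fun y => X y c b) (t • x)) x]
    have key : ∑ a, t ^ 2 * x a * pd c (fun y => X y a b) (t • x)
        - ∑ a, t ^ 2 * x a * pd b (fun y => X y a c) (t • x)
        = t ^ 2 * ∑ a, x a * pd a (fun y => X y c b) (t • x) := by
      rw [← Finset.sum_sub_distrib, Finset.mul_sum]
      refine Finset.sum_congr rfl fun a _ => ?_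
      have := hclosed (t • x) a b c
      rw [hpa _ b c, hpa _ c a] at this
      linear_combination (t ^ 2 * x a) * this
    have ha := hanti (t • x) b c
    change _ = _ + ∑ a, t ^ 2 * x a * pd c (fun y => X y a b) (t • x) -
      (_ + ∑ a, t ^ 2 * x a * pd b (fun y => X y a c) (t • x))
    simp only [pd, Function.comp] at key ⊢
    push_cast
    linear_combination (-1) * key + t * ha

lemma raise2_pd (X : (Fin 4 → ℝ) → Fin 4 → Fin 4 → ℝ)
    (hsmooth : ∀ a b, ContDiff ℝ (⊤ : ℕ∞) (fun x => X x a b)) (x : Fin 4 → ℝ) (e a b : Fin 4) :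
    pd e (fun y => raise2 (X y) a b) x = raise2 (fun c d => pd e (fun y => X y c d) x) a b := by
  have h : HasFDerivAt (fun y => raise2 (X y) a b)
      (∑ c, ∑ d, (mink a c * mink b d) • fderiv ℝ (fun y => X y c d) x) x := by
    unfold raise2
    exact HasFDerivAt.fun_sum fun c _ => HasFDerivAt.fun_sum fun d _ =>
      (((hsmooth c d).differentiable (by simp) x).hasFDerivAt).const_mul _
  unfold pd
  rw [h.fderiv]
  simp [raise2]

lemma raise2_smooth (X : (Fin 4 → ℝ) → Fin 4 → Fin 4 → ℝ)
    (hsmooth : ∀ a b, ContDiff ℝ (⊤ : ℕ∞) (fun x => X x a b)) (a b : Fin 4) :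
    ContDiff ℝ (⊤ : ℕ∞) (fun y => raise2 (X y) a b) := by
  unfold raise2
  exact ContDiff.sum fun c _ => ContDiff.sum fun d _ => contDiff_const.mul (hsmooth c d)

lemma hodge_smooth (X : (Fin 4 → ℝ) → Fin 4 → Fin 4 → ℝ)
    (hsmooth : ∀ a b, ContDiff ℝ (⊤ : ℕ∞) (fun x => X x a b)) (a b : Fin 4) :
    ContDiff ℝ (⊤ : ℕ∞) (fun y => hodge (X y) a b) := by
  unfold hodge
  exact contDiff_const.mul (ContDiff.sum fun c _ => ContDiff.sum fun d _ =>
    contDiff_const.mul (raise2_smooth X hsmooth c d))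

lemma hodge_pd (X : (Fin 4 → ℝ) → Fin 4 → Fin 4 → ℝ)
    (hsmooth : ∀ a b, ContDiff ℝ (⊤ : ℕ∞) (fun x => X x a b)) (x : Fin 4 → ℝ) (e a b : Fin 4) :
    pd e (fun y => hodge (X y) a b) x = hodge (fun c d => pd e (fun y => X y c d) x) a b := by
  have h : HasFDerivAt (fun y => hodge (X y) a b)
      ((1 / 2 : ℝ) • ∑ c, ∑ d, (lev a b c d) • fderiv ℝ (fun y => raise2 (X y) c d) x) x := by
    unfold hodge
    exact HasFDerivAt.const_mul (HasFDerivAt.fun_sum fun c _ => HasFDerivAt.fun_sum fun d _ =>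
      (((raise2_smooth X hsmooth c d).differentiable (by simp) x).hasFDerivAt).const_mul _) _
  have h3 := raise2_pd X hsmooth x e
  unfold pd at h3 ⊢
  rw [h.fderiv]
  simp [hodge, h3]

lemma hodge_anti (Y : Fin 4 → Fin 4 → ℝ) (a b : Fin 4) : hodge Y a b = - hodge Y b a := by
  unfold hodge
  rw [← mul_neg, ← Finset.sum_neg_distrib]
  congr 1
  refine Finset.sum_congr rfl fun c _ => ?_
  rw [← Finset.sum_neg_distrib]
  refine Finset.sum_congr rfl fun d _ => ?_
  unfold lev
  ring

lemma raise2_eq (Y : Fin 4 → Fin 4 → ℝ) (a b : Fin 4) :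
    raise2 Y a b = mink a a * mink b b * Y a b := by
  unfold raise2
  rw [Finset.sum_eq_single a, Finset.sum_eq_single b]
  · intro d _ hd; simp [mink, hd.symm]
  · simp
  · intro d _ hd; simp [mink, hd.symm]
  · simp

set_option maxHeartbeats 2000000 in
lemma hodge_closed (P : Fin 4 → Fin 4 → Fin 4 → ℝ) (hP : ∀ e a b, P e a b = - P e b a)
    (hc : ∀ a, ∑ b, raise2 (P b) a b = 0) (a b c : Fin 4) :
    hodge (P a) b c + hodge (P b) c a + hodge (P c) a b = 0 := by
  set R : Fin 4 → Fin 4 → Fin 4 → ℝ := fun e => raise2 (P e) with hR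
  have hRa : ∀ e a b, R e a b = - R e b a := by
    intro e a b; simp only [hR, raise2_eq]; rw [hP e a b]; ring
  change ∀ a, ∑ b, R b a b = 0 at hc
  have hh : ∀ e a b, hodge (P e) a b = (1 / 2) * ∑ c, ∑ d, lev a b c d * R e c d :=
    fun e a b => rfl
  rw [hh, hh, hh]
  clear_value R
  have c0 := hc 0
  have c1 := hc 1
  have c2 := hc 2
  have c3 := hc 3
  have d (e : Fin 4) (i : Fin 4) : R e i i = 0 := by linarith [hRa e i i]
  have d10 (e : Fin 4) := hRa e 1 0
  have d20 (e : Fin 4) := hRa e 2 0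
  have d30 (e : Fin 4) := hRa e 3 0
  have d21 (e : Fin 4) := hRa e 2 1
  have d31 (e : Fin 4) := hRa e 3 1
  have d32 (e : Fin 4) := hRa e 3 2
  simp only [Fin.sum_univ_four, d, d10, d20, d30, d21, d31, d32] at c0 c1 c2 c3 ⊢
  fin_cases a <;> fin_cases b <;> fin_cases c <;> simp [lev] <;> norm_num <;> linarith

/-- A smooth closed and co-closed field of antisymmetric matrices admits two
co-potential vector fields `U, V` with `X = dU` and `*X = dV`. -/
theorem copotentials_exist
    (X : (Fin 4 → ℝ) → Fin 4 → Fin 4 → ℝ)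
    (hanti : ∀ x a b, X x a b = - X x b a)
    (hsmooth : ∀ a b, ContDiff ℝ (⊤ : ℕ∞) (fun x => X x a b))
    (hclosed : ∀ (x : Fin 4 → ℝ) (a b c : Fin 4),
      pd a (fun y => X y b c) x + pd b (fun y => X y c a) x
        + pd c (fun y => X y a b) x = 0)
    (hcoclosed : ∀ (x : Fin 4 → ℝ) (a : Fin 4), alphaCurrent X a x = 0) :
    ∃ U V : (Fin 4 → ℝ) → Fin 4 → ℝ,
      (∀ a, ContDiff ℝ (⊤ : ℕ∞) (fun x => U x a)) ∧
      (∀ a, ContDiff ℝ (⊤ : ℕ∞) (fun x => V x a)) ∧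
      (∀ (x : Fin 4 → ℝ) (a b : Fin 4),
        X x a b = pd a (fun y => U y b) x - pd b (fun y => U y a) x) ∧
      (∀ (x : Fin 4 → ℝ) (a b : Fin 4),
        hodge (X x) a b = pd a (fun y => V y b) x - pd b (fun y => V y a) x) := by
  obtain ⟨U, hU, hU2⟩ := poincare2 X hanti hsmooth hclosed
  obtain ⟨V, hV, hV2⟩ := poincare2 (fun x => hodge (X x)) (fun x => hodge_anti (X x))
    (hodge_smooth X hsmooth) (by
      intro x a b c
      rw [hodge_pd X hsmooth, hodge_pd X hsmooth, hodge_pd X hsmooth]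
      refine hodge_closed (fun e c d => pd e (fun y => X y c d) x) ?_ ?_ a b c
      · intro e a b
        have : (fun y => X y a b) = fun y => - X y b a := funext fun y => hanti y a b
        simp only [this]
        simp [pd]
      · intro a
        have := hcoclosed x a
        unfold alphaCurrent at this
        simpa only [raise2_pd X hsmooth] using this)
  exact ⟨U, V, hU, hV, hU2, hV2⟩
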